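/- Let m be a positive integer and c₁, c₂ complex numbers, neither an integer, with Re(c₁ + c₂) < m + 1. Then Σ_{k=0}^∞ [(c₁)_k (c₂)_k / ((m+k)! k!)] · [ψ(1+k) + ψ(1+m+k) - ψ(c₁+k) - ψ(c₂+k)] = π (cot(πc₁) + cot(πc₂)) · Γ(1+m-c₁-c₂) / (Γ(1+m-c₁) Γ(1+m-c₂)) + (1/((1-c₁)(1-c₂)(m-1)!)) · Σ_{k=0}^{m-1} (1-m)_k k! / ((2-c₁)_k (2-c₂)_k). -/

import Mathlib

open Complex Finset

noncomputable def ψ (z : ℂ) : ℂ := deriv Complex.Gamma z / Complex.Gamma z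

noncomputable def rf (x : ℂ) (n : ℕ) : ℂ := ∏ j ∈ Finset.range n, (x + j)

open Filter Topology

/-- The terms of the Gauss hypergeometric series at `1`, divided by `Γ(c)`. -/
noncomputable def gaussTerm (a b c : ℂ) (k : ℕ) : ℂ :=
  rf a k * rf b k * (Gamma (c + k))⁻¹ / (Nat.factorial k : ℂ)

lemma rf_zero (x : ℂ) : rf x 0 = 1 := by simp [rf]

lemma rf_succ (x : ℂ) (n : ℕ) : rf x (n + 1) = rf x n * (x + n) := by
  simp [rf, Finset.prod_range_succ]

lemma rf_add (x : ℂ) (n k : ℕ) : rf x (n + k) = rf x n * rf (x + n) k := by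
  simp [rf, Finset.prod_range_add, add_assoc]

lemma inv_Gamma_eq (z : ℂ) : (Gamma z)⁻¹ = z * (Gamma (z + 1))⁻¹ :=
  one_div_Gamma_eq_self_mul_one_div_Gamma_add_one z

lemma gaussTerm_succ (a b c : ℂ) (k : ℕ) :
    gaussTerm a b c (k + 1) * (c + k) * (k + 1) = gaussTerm a b c k * ((a + k) * (b + k)) := by
  have hk : (k : ℂ) + 1 ≠ 0 := by exact_mod_cast k.succ_ne_zero
  have hf : (Nat.factorial k : ℂ) ≠ 0 := by exact_mod_cast k.factorial_ne_zero
  rw [gaussTerm, gaussTerm, inv_Gamma_eq (c + k), rf_succ, rf_succ, Nat.factorial_succ]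
  push_cast
  rw [← add_assoc]
  field_simp

lemma gaussTerm_add_one (a b c : ℂ) (k : ℕ) :
    gaussTerm a b c k = (c + k) * gaussTerm a b (c + 1) k := by
  rw [gaussTerm, gaussTerm, inv_Gamma_eq (c + k), add_right_comm]
  ring

lemma differentiable_rf (n : ℕ) : Differentiable ℂ fun x => rf x n := by
  unfold rf
  fun_prop

lemma differentiable_gaussTerm {a b c : ℂ → ℂ} (ha : Differentiable ℂ a) (hb : Differentiable ℂ b)
    (hc : Differentiable ℂ c) (k : ℕ) :
    Differentiable ℂ fun z => gaussTerm (a z) (b z) (c z) k := by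
  unfold gaussTerm
  have h1 := (differentiable_rf k).comp ha
  have h2 := (differentiable_rf k).comp hb
  have h3 := differentiable_one_div_Gamma.comp (hc.add_const (k : ℂ))
  exact ((h1.mul h2).mul h3).div_const _

lemma norm_add_natCast_le {a : ℂ} {τ : ℝ} (hτ : 0 < τ) {k : ℕ} (hk : ‖a‖ ^ 2 ≤ 2 * k * τ) :
    ‖a + k‖ ≤ k + a.re + τ := by
  have hk0 : (0 : ℝ) ≤ k := k.cast_nonneg
  have hsq : ‖a + k‖ ^ 2 = k ^ 2 + 2 * k * a.re + ‖a‖ ^ 2 := by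
    rw [← normSq_eq_norm_sq, ← normSq_eq_norm_sq, normSq_apply, normSq_apply]
    simp
    ring
  have hre : a.re ^ 2 ≤ ‖a‖ ^ 2 := sq_le_sq' (by linarith [abs_le.1 (abs_re_le_norm a)])
    (re_le_norm a)
  refine le_of_sq_le_sq ?_ ?_
  · nlinarith [sq_nonneg (a.re + τ)]
  · by_contra! h
    nlinarith

/-- Uniform control of the ratio of consecutive hypergeometric terms. -/
lemma exists_norm_add_natCast_mul_le (M p : ℝ) {η : ℝ} (hη : 0 < η) :
    ∃ K : ℕ, ∀ k ≥ K, ∀ a b c : ℂ, ‖a‖ ≤ M → ‖b‖ ≤ M → ‖c‖ ≤ M → p - 1 + η ≤ (c - a - b).re →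
      0 < ‖c + k‖ ∧ ‖a + k‖ * ‖b + k‖ ≤ (k + 1 - p) * ‖c + k‖ := by
  set τ := η / 4 with hτ
  obtain ⟨K, hK⟩ := exists_nat_ge
    (max (max (M ^ 2 / (2 * τ)) p) (max (M + 1) (((M + τ) ^ 2 + |1 - p| * M) / (η / 2))))
  refine ⟨K, fun k hk a b c ha hb hc h => ?_⟩
  have hkK : (K : ℝ) ≤ k := by exact_mod_cast hk
  simp only [max_le_iff] at hK
  obtain ⟨⟨h1, h2⟩, h3, h4⟩ := hK
  have hτ0 : 0 < τ := by positivity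
  rw [div_le_iff₀ (by positivity)] at h1 h4
  have hM : 0 ≤ M := (norm_nonneg a).trans ha
  have hMk : M ^ 2 ≤ 2 * k * τ := by nlinarith
  have ha' := norm_add_natCast_le hτ0 ((pow_le_pow_left₀ (norm_nonneg a) ha 2).trans hMk)
  have hb' := norm_add_natCast_le hτ0 ((pow_le_pow_left₀ (norm_nonneg b) hb 2).trans hMk)
  have hc' : k + c.re ≤ ‖c + k‖ := by
    simpa [add_comm] using re_le_norm (c + k)
  have ra := abs_le.1 ((abs_re_le_norm a).trans ha)
  have rb := abs_le.1 ((abs_re_le_norm b).trans hb)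
  have rc := abs_le.1 ((abs_re_le_norm c).trans hc)
  simp only [sub_re] at h
  refine ⟨by linarith, ?_⟩
  have hprod : (a.re + τ) * (b.re + τ) ≤ (M + τ) ^ 2 := by
    have h5 : |(a.re + τ) * (b.re + τ)| ≤ (M + τ) * (M + τ) := by
      rw [abs_mul]
      exact mul_le_mul (abs_le.2 ⟨by linarith, by linarith⟩)
        (abs_le.2 ⟨by linarith, by linarith⟩) (abs_nonneg _) (by linarith)
    nlinarith [le_abs_self ((a.re + τ) * (b.re + τ))]
  have hpc : -(|1 - p| * M) ≤ (1 - p) * c.re := by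
    have h5 : |(1 - p) * c.re| ≤ |1 - p| * M := by
      rw [abs_mul]
      exact mul_le_mul_of_nonneg_left (abs_le.2 rc) (abs_nonneg _)
    linarith [neg_abs_le ((1 - p) * c.re)]
  calc ‖a + k‖ * ‖b + k‖ ≤ (k + a.re + τ) * (k + b.re + τ) :=
        mul_le_mul ha' hb' (norm_nonneg _) ((norm_nonneg _).trans ha')
    _ ≤ (k + 1 - p) * (k + c.re) := by
        have h6 : (k : ℝ) * (p - 1 + η) ≤ k * (c.re - a.re - b.re) :=
          mul_le_mul_of_nonneg_left h k.cast_nonneg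
        have h7 : K * (η / 2) ≤ k * (η / 2) := by gcongr
        have h8 : (k : ℝ) * τ = k * η / 4 := by rw [hτ]; ring
        nlinarith
    _ ≤ (k + 1 - p) * ‖c + k‖ := by
        gcongr
        linarith

lemma sub_mul_rpow_le {p : ℝ} (hp : 1 ≤ p) (k : ℕ) :
    ((k : ℝ) + 1 - p) * ((k : ℝ) + 2) ^ p ≤ (k + 1) * ((k : ℝ) + 1) ^ p := by
  have h2 : (0 : ℝ) < k + 2 := by positivity
  have hB := one_add_mul_self_le_rpow_one_add (s := -1 / ((k : ℝ) + 2))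
    (by rw [le_div_iff₀ h2]; linarith [(k.cast_nonneg : (0 : ℝ) ≤ k)]) hp
  have he : 1 + -1 / ((k : ℝ) + 2) = (k + 1) / (k + 2) := by field_simp; ring
  rw [he, Real.div_rpow (by positivity) h2.le, le_div_iff₀ (by positivity)] at hB
  refine le_trans ?_ (mul_le_mul_of_nonneg_left hB (by positivity : (0 : ℝ) ≤ k + 1))
  rw [← mul_assoc]
  gcongr
  have : (k + 1) * (1 + p * (-1 / ((k : ℝ) + 2))) - (k + 1 - p) = p / (k + 2) := by
    field_simp
    ring
  have : 0 ≤ p / ((k : ℝ) + 2) := by positivity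
  linarith

/-- A majorant for the Gauss series which is locally uniform in the parameters. -/
lemma eventually_norm_gaussTerm_mul_le {a b c : ℂ → ℂ} (ha : Differentiable ℂ a)
    (hb : Differentiable ℂ b) (hc : Differentiable ℂ c) {z : ℂ}
    (hre : 0 < (c z - a z - b z).re) :
    ∃ p > (1 : ℝ), ∃ C : ℝ, ∀ᶠ w in 𝓝 z, ∀ k : ℕ,
      ‖gaussTerm (a w) (b w) (c w) k‖ * ((k : ℝ) + 1) ^ p ≤ C := by
  set δ := (c z - a z - b z).re with hδ
  set p := 1 + δ / 4 with hp
  have hp1 : 1 < p := by linarith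
  set M := max (max (‖a z‖ + 1) (‖b z‖ + 1)) (‖c z‖ + 1) with hM
  obtain ⟨K, hK⟩ := exists_norm_add_natCast_mul_le M p (η := δ / 4) (by linarith)
  have hcont := fun k => (differentiable_gaussTerm ha hb hc k).continuous
  refine ⟨p, hp1, ∑ k ∈ Finset.range (K + 1),
    (‖gaussTerm (a z) (b z) (c z) k‖ + 1) * ((k : ℝ) + 1) ^ p, ?_⟩
  have e1 : ∀ᶠ w in 𝓝 z, ‖a w‖ < ‖a z‖ + 1 :=
    ha.continuous.norm.continuousAt.eventually_lt_const (by linarith)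
  have e2 : ∀ᶠ w in 𝓝 z, ‖b w‖ < ‖b z‖ + 1 :=
    hb.continuous.norm.continuousAt.eventually_lt_const (by linarith)
  have e3 : ∀ᶠ w in 𝓝 z, ‖c w‖ < ‖c z‖ + 1 :=
    hc.continuous.norm.continuousAt.eventually_lt_const (by linarith)
  have e4 : ∀ᶠ w in 𝓝 z, δ / 2 < (c w - a w - b w).re :=
    (continuous_re.comp ((hc.sub ha).sub hb).continuous).continuousAt.eventually_const_lt
      (by simp only [Function.comp, Pi.sub_apply]; rw [← hδ]; linarith)
  have e5 : ∀ᶠ w in 𝓝 z, ∀ k ∈ Finset.range (K + 1),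
      ‖gaussTerm (a w) (b w) (c w) k‖ < ‖gaussTerm (a z) (b z) (c z) k‖ + 1 :=
    (eventually_all_finset _).2 fun k _ =>
      (hcont k).norm.continuousAt.eventually_lt_const (by linarith)
  filter_upwards [e1, e2, e3, e4, e5] with w w1 w2 w3 w4 w5 k
  have hsmall : ∀ k ≤ K, ‖gaussTerm (a w) (b w) (c w) k‖ * ((k : ℝ) + 1) ^ p ≤
      ∑ k ∈ Finset.range (K + 1),
        (‖gaussTerm (a z) (b z) (c z) k‖ + 1) * ((k : ℝ) + 1) ^ p := fun k hk => by
    have hmem : k ∈ Finset.range (K + 1) := Finset.mem_range.2 (by omega)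
    refine le_trans ?_ (Finset.single_le_sum (f := fun k : ℕ =>
      (‖gaussTerm (a z) (b z) (c z) k‖ + 1) * ((k : ℝ) + 1) ^ p)
      (fun i _ => by positivity) hmem)
    have := (w5 k hmem).le
    gcongr
  rcases le_total k K with hk | hk
  · exact hsmall k hk
  induction k, hk using Nat.le_induction with
  | base => exact hsmall K le_rfl
  | succ k hk ih =>
    refine le_trans ?_ ih
    obtain ⟨hpos, hle⟩ := hK k hk (a w) (b w) (c w)
      (w1.le.trans (by simp [hM])) (w2.le.trans (by simp [hM])) (w3.le.trans (by simp [hM]))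
      (by linarith)
    have hrec := congrArg norm (gaussTerm_succ (a w) (b w) (c w) k)
    have hk1 : ‖(k : ℂ) + 1‖ = k + 1 := by exact_mod_cast Complex.norm_natCast (k + 1)
    rw [norm_mul, norm_mul, norm_mul, norm_mul, hk1] at hrec
    set t := ‖gaussTerm (a w) (b w) (c w) k‖
    set t' := ‖gaussTerm (a w) (b w) (c w) (k + 1)‖
    have ht : 0 ≤ t := norm_nonneg _
    have h1 : t' * (k + 1) ≤ t * (k + 1 - p) := by
      refine le_of_mul_le_mul_right ?_ hpos
      calc t' * (k + 1) * ‖c w + k‖ = t * (‖a w + k‖ * ‖b w + k‖) := by rw [← hrec]; ring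
        _ ≤ t * ((k + 1 - p) * ‖c w + k‖) := by gcongr
        _ = _ := by ring
    have h2 := sub_mul_rpow_le hp1.le k
    have hk0 : (0 : ℝ) < k + 1 := by positivity
    push_cast
    rw [add_assoc (k : ℝ) 1 1, one_add_one_eq_two]
    refine le_of_mul_le_mul_right ?_ hk0
    calc t' * ((k : ℝ) + 2) ^ p * (k + 1) = t' * (k + 1) * ((k : ℝ) + 2) ^ p := by ring
      _ ≤ t * (k + 1 - p) * ((k : ℝ) + 2) ^ p := by gcongr
      _ = t * ((k + 1 - p) * ((k : ℝ) + 2) ^ p) := by ring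
      _ ≤ t * ((k + 1) * ((k : ℝ) + 1) ^ p) := by gcongr
      _ = _ := by ring

lemma summable_const_div_rpow (C : ℝ) {p : ℝ} (hp : 1 < p) :
    Summable fun k : ℕ => C / ((k : ℝ) + 1) ^ p := by
  have h := (summable_nat_add_iff 1).2 (Real.summable_nat_rpow_inv.2 hp)
  simpa [div_eq_mul_inv] using h.mul_left C

lemma hasSum_deriv_gaussTerm {a b c : ℂ → ℂ} (ha : Differentiable ℂ a) (hb : Differentiable ℂ b)
    (hc : Differentiable ℂ c) {z : ℂ} (hre : 0 < (c z - a z - b z).re) :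
    HasSum (fun k => deriv (fun w => gaussTerm (a w) (b w) (c w) k) z)
      (deriv (fun w => ∑' k, gaussTerm (a w) (b w) (c w) k) z) := by
  obtain ⟨p, hp, C, h⟩ := eventually_norm_gaussTerm_mul_le ha hb hc hre
  obtain ⟨U, hU, hUo, hz⟩ := eventually_nhds_iff.1 h
  refine hasSum_deriv_of_summable_norm (summable_const_div_rpow C hp)
    (fun k => (differentiable_gaussTerm ha hb hc k).differentiableOn) hUo (fun k w hw => ?_) hz
  rw [le_div_iff₀ (by positivity)]
  exact hU w hw k

lemma exists_norm_gaussTerm_le {a b c : ℂ} (hre : 0 < (c - a - b).re) :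
    ∃ p > (1 : ℝ), ∃ C : ℝ, ∀ k : ℕ, ‖gaussTerm a b c k‖ ≤ C / ((k : ℝ) + 1) ^ p := by
  obtain ⟨p, hp, C, h⟩ := eventually_norm_gaussTerm_mul_le (a := fun _ => a) (b := fun _ => b)
    (c := fun _ => c) (z := 0) (by fun_prop) (by fun_prop) (by fun_prop) hre
  refine ⟨p, hp, C, fun k => ?_⟩
  rw [le_div_iff₀ (by positivity)]
  exact h.self_of_nhds k

lemma summable_gaussTerm {a b c : ℂ} (hre : 0 < (c - a - b).re) :
    Summable (gaussTerm a b c) := by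
  obtain ⟨p, hp, C, h⟩ := exists_norm_gaussTerm_le hre
  exact .of_norm_bounded (summable_const_div_rpow C hp) h

lemma tendsto_natCast_mul_gaussTerm {a b c : ℂ} (hre : 0 < (c - a - b).re) :
    Tendsto (fun k : ℕ => k * gaussTerm a b c k) atTop (𝓝 0) := by
  obtain ⟨p, hp, C, h⟩ := exists_norm_gaussTerm_le hre
  have hlim : Tendsto (fun k : ℕ => C * ((k : ℝ) + 1) ^ (-(p - 1))) atTop (𝓝 (C * 0)) :=
    ((tendsto_rpow_neg_atTop (by linarith)).comp
      (tendsto_atTop_add_const_right _ 1 tendsto_natCast_atTop_atTop)).const_mul C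
  rw [mul_zero] at hlim
  refine squeeze_zero_norm (fun k => ?_) hlim
  have hk : (0 : ℝ) < k + 1 := by positivity
  rw [norm_mul, norm_natCast, neg_sub, Real.rpow_sub hk, Real.rpow_one]
  calc k * ‖gaussTerm a b c k‖ ≤ (k + 1) * (C / ((k : ℝ) + 1) ^ p) := by
        gcongr
        · linarith
        · exact h k
    _ = _ := by ring

lemma Gamma_add_natCast {z : ℂ} (hz : ∀ n : ℕ, z ≠ -n) (n : ℕ) :
    Gamma (z + n) = rf z n * Gamma z := by
  induction n with
  | zero => simp [rf_zero]
  | succ n ih =>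
    have h : z + n ≠ 0 := fun h => hz n (eq_neg_of_add_eq_zero_left h)
    rw [Nat.cast_succ, ← add_assoc, Gamma_add_one _ h, ih, rf_succ]
    ring

/-- The value of the Gauss hypergeometric series at `1`, divided by `Γ(c)`. -/
noncomputable def gaussValue (a b c : ℂ) : ℂ :=
  Gamma (c - a - b) * (Gamma (c - a))⁻¹ * (Gamma (c - b))⁻¹

lemma gaussValue_add_one {a b c : ℂ} (h : c - a - b ≠ 0) :
    (c - a - b) * gaussValue a b c = (c - a) * (c - b) * gaussValue a b (c + 1) := by
  have e1 : c + 1 - a - b = c - a - b + 1 := by ring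
  have e2 : c + 1 - a = c - a + 1 := by ring
  have e3 : c + 1 - b = c - b + 1 := by ring
  rw [gaussValue, gaussValue, e1, e2, e3, Gamma_add_one _ h, inv_Gamma_eq (c - a),
    inv_Gamma_eq (c - b)]
  ring

lemma tsum_gaussTerm_add_one {a b c : ℂ} (hre : 0 < (c - a - b).re) :
    (c - a - b) * ∑' k, gaussTerm a b c k =
      (c - a) * (c - b) * ∑' k, gaussTerm a b (c + 1) k := by
  have hre' : 0 < (c + 1 - a - b).re := by
    simp only [sub_re, add_re, one_re] at hre ⊢
    linarith
  have hs := summable_gaussTerm hre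
  have hs' := summable_gaussTerm hre'
  have key : ∀ k : ℕ, (c - a - b) * gaussTerm a b c k -
      (c - a) * (c - b) * gaussTerm a b (c + 1) k =
      k * gaussTerm a b c k - ((k + 1 : ℕ) : ℂ) * gaussTerm a b c (k + 1) := fun k => by
    have h1 := gaussTerm_succ a b (c + 1) k
    rw [gaussTerm_add_one a b c (k + 1), gaussTerm_add_one a b c k]
    push_cast
    linear_combination h1
  have htel : HasSum (fun k : ℕ => (k : ℂ) * gaussTerm a b c k -
      ((k + 1 : ℕ) : ℂ) * gaussTerm a b c (k + 1)) 0 := by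
    have hsum : Summable (fun k : ℕ => (k : ℂ) * gaussTerm a b c k -
        ((k + 1 : ℕ) : ℂ) * gaussTerm a b c (k + 1)) := by
      simp_rw [← key]
      exact (hs.mul_left _).sub (hs'.mul_left _)
    refine (hsum.hasSum_iff_tendsto_nat).2 ?_
    simp_rw [Finset.sum_range_sub']
    simpa using (tendsto_natCast_mul_gaussTerm hre).neg
  simp_rw [← key] at htel
  have h2 := htel.unique ((hs.hasSum.mul_left _).sub (hs'.hasSum.mul_left _))
  exact (sub_eq_zero.1 h2.symm)

lemma Gamma_add_natCast_eq_div {z : ℂ} (hz : ∀ n : ℕ, z ≠ -n) {n : ℕ} (hG : GammaSeq z n ≠ 0) :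
    Gamma (z + (n + 1 : ℕ)) = (n : ℂ) ^ z * Nat.factorial n * (Gamma z / GammaSeq z n) := by
  have hne : rf z (n + 1) ≠ 0 := fun h => hG (by rw [GammaSeq]; exact div_eq_zero_iff.2 (.inr h))
  have hdef : GammaSeq z n = (n : ℂ) ^ z * Nat.factorial n / rf z (n + 1) := rfl
  have hnum : (n : ℂ) ^ z * Nat.factorial n ≠ 0 := fun h => hG (by rw [hdef, h, zero_div])
  rw [Gamma_add_natCast hz, hdef, div_div_eq_mul_div, mul_div_cancel₀ _ hnum, mul_comm]

lemma ne_neg_natCast_of_re_pos {z : ℂ} (h : 0 < z.re) (n : ℕ) : z ≠ -n := by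
  rintro rfl
  simp at h
  linarith [(n.cast_nonneg : (0 : ℝ) ≤ n)]

lemma tendsto_Gamma_div_GammaSeq {z : ℂ} (h : 0 < z.re) :
    Tendsto (fun n => Gamma z / GammaSeq z n) atTop (𝓝 1) := by
  have hG := Gamma_ne_zero_of_re_pos h
  rw [← div_self hG]
  exact tendsto_const_nhds.div (GammaSeq_tendsto_Gamma z) hG

lemma tendsto_Gamma_mul_gaussValue {a b c : ℂ} (h0 : 0 < c.re) (h1 : 0 < (c - a).re)
    (h2 : 0 < (c - b).re) (h3 : 0 < (c - a - b).re) :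
    Tendsto (fun n : ℕ => Gamma (c + (n + 1 : ℕ)) * gaussValue a b (c + (n + 1 : ℕ))) atTop
      (𝓝 1) := by
  have hne : ∀ {z : ℂ}, 0 < z.re → ∀ᶠ n in atTop, GammaSeq z n ≠ 0 := fun {z} hz =>
    (GammaSeq_tendsto_Gamma z).eventually_ne (Gamma_ne_zero_of_re_pos hz)
  have hlim := ((tendsto_Gamma_div_GammaSeq h0).mul (tendsto_Gamma_div_GammaSeq h3)).mul
    (((tendsto_Gamma_div_GammaSeq h1).mul (tendsto_Gamma_div_GammaSeq h2)).inv₀ (by simp))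
  simp only [mul_one, inv_one] at hlim
  refine hlim.congr' ?_
  filter_upwards [hne h0, hne h1, hne h2, hne h3, eventually_ne_atTop 0] with n n0 n1 n2 n3 hn
  have hn' : (n : ℂ) ≠ 0 := by exact_mod_cast hn
  have hf : (Nat.factorial n : ℂ) ≠ 0 := by exact_mod_cast n.factorial_ne_zero
  have e1 : c + (n + 1 : ℕ) - a - b = c - a - b + (n + 1 : ℕ) := by ring
  have e2 : c + (n + 1 : ℕ) - a = c - a + (n + 1 : ℕ) := by ring
  have e3 : c + (n + 1 : ℕ) - b = c - b + (n + 1 : ℕ) := by ring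
  rw [gaussValue, e1, e2, e3, Gamma_add_natCast_eq_div (ne_neg_natCast_of_re_pos h0) n0,
    Gamma_add_natCast_eq_div (ne_neg_natCast_of_re_pos h1) n1,
    Gamma_add_natCast_eq_div (ne_neg_natCast_of_re_pos h2) n2,
    Gamma_add_natCast_eq_div (ne_neg_natCast_of_re_pos h3) n3]
  have hpow : (n : ℂ) ^ c * (n : ℂ) ^ (c - a - b) = (n : ℂ) ^ (c - a) * (n : ℂ) ^ (c - b) := by
    rw [← cpow_add _ _ hn', ← cpow_add _ _ hn']
    ring_nf
  have hp1 : (n : ℂ) ^ (c - a) ≠ 0 := by simp [cpow_eq_zero_iff, hn]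
  have hp2 : (n : ℂ) ^ (c - b) ≠ 0 := by simp [cpow_eq_zero_iff, hn]
  simp only [mul_inv]
  calc _ = ((n : ℂ) ^ (c - a) * (n : ℂ) ^ (c - b) * ((n : ℂ) ^ (c - a))⁻¹ *
        ((n : ℂ) ^ (c - b))⁻¹) * ((Nat.factorial n : ℂ) * (Nat.factorial n : ℂ)⁻¹) ^ 2 *
        (Gamma c / GammaSeq c n * (Gamma (c - a - b) / GammaSeq (c - a - b) n) *
          ((Gamma (c - a) / GammaSeq (c - a) n)⁻¹ * (Gamma (c - b) / GammaSeq (c - b) n)⁻¹)) := by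
        rw [mul_inv_cancel₀ hf]
        field_simp
    _ = _ := by
        rw [← hpow]
        ring

lemma norm_rf_ofReal_le {x : ℝ} (hx : 0 < x) {z : ℂ} (hz : x ≤ z.re) (k : ℕ) :
    ‖rf x k‖ ≤ ‖rf z k‖ := by
  rw [rf, rf, norm_prod, norm_prod]
  refine Finset.prod_le_prod (fun _ _ => norm_nonneg _) fun j _ => ?_
  have h1 : ‖(x : ℂ) + j‖ = x + j := by
    rw [← ofReal_natCast, ← ofReal_add, norm_real, Real.norm_of_nonneg (by positivity)]
  rw [h1]
  refine le_trans ?_ (re_le_norm _)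
  simpa using hz

lemma tendsto_inv_rf (c : ℂ) (k : ℕ) :
    Tendsto (fun n : ℕ => (rf (c + (n + 1 : ℕ)) k)⁻¹) atTop (𝓝 (0 ^ k)) := by
  simp only [rf, ← Finset.prod_inv_distrib]
  have : (0 : ℂ) ^ k = ∏ j ∈ Finset.range k, 0 := by simp
  rw [this]
  refine tendsto_finsetProd _ fun j _ => ?_
  refine tendsto_inv₀_cobounded.comp ?_
  have h : Tendsto (fun n : ℕ => ((n + 1 : ℕ) : ℂ)) atTop (Bornology.cobounded ℂ) :=
    tendsto_norm_atTop_iff_cobounded.1 <| by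
      simp only [Complex.norm_natCast]
      exact tendsto_natCast_atTop_atTop.comp (tendsto_add_atTop_nat 1)
  have h2 := tendsto_add_const_cobounded (c + j) |>.comp h
  refine h2.congr fun n => ?_
  simp only [Function.comp]
  ring

lemma tendsto_Gamma_mul_tsum_gaussTerm {a b c : ℂ} (h0 : 0 < c.re) (h : (a + b).re < c.re) :
    Tendsto (fun n : ℕ => Gamma (c + (n + 1 : ℕ)) * ∑' k, gaussTerm a b (c + (n + 1 : ℕ)) k) atTop
      (𝓝 1) := by
  set x : ℂ := (c.re : ℂ) with hx
  have hxre : 0 < x.re := by simpa [hx]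
  have hform : ∀ {z : ℂ}, 0 < z.re → ∀ k, Gamma z * gaussTerm a b z k =
      rf a k * rf b k / Nat.factorial k * (rf z k)⁻¹ := fun {z} hz k => by
    rw [gaussTerm, Gamma_add_natCast (ne_neg_natCast_of_re_pos hz)]
    have := Gamma_ne_zero_of_re_pos hz
    field_simp
  have hsum : Summable fun k => ‖Gamma x * gaussTerm a b x k‖ := by
    refine ((summable_gaussTerm ?_).mul_left _).norm
    simp [hx] at h ⊢
    linarith
  have hre : ∀ n : ℕ, c.re ≤ (c + (n + 1 : ℕ)).re := fun n => by
    simp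
    positivity
  have hlim := tendsto_tsum_of_dominated_convergence
    (f := fun (n : ℕ) k => rf a k * rf b k / Nat.factorial k * (rf (c + (n + 1 : ℕ)) k)⁻¹)
    (𝓕 := atTop) hsum
    (fun k => (tendsto_inv_rf c k).const_mul (rf a k * rf b k / Nat.factorial k))
    (Eventually.of_forall fun n k => by
      rw [hform hxre, norm_mul, norm_mul _ (rf x k)⁻¹, norm_inv, norm_inv]
      have hpos : rf x k ≠ 0 := by
        rw [rf, Finset.prod_ne_zero_iff]
        intro j _ hj
        exact ne_neg_natCast_of_re_pos hxre j (eq_neg_of_add_eq_zero_left hj)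
      gcongr
      · exact norm_rf_ofReal_le h0 (hre n) k)
  rw [tsum_eq_single 0 (fun k hk => by simp [hk])] at hlim
  simp only [rf_zero, Nat.factorial_zero, Nat.cast_one, pow_zero, mul_one, div_one] at hlim
  refine hlim.congr fun n => ?_
  rw [← tsum_mul_left]
  exact tsum_congr fun k => (hform (h0.trans_le (hre n)) k).symm

/-- **Gauss's summation theorem**, divided by `Γ(c)` so as to need no condition on `c`. -/
theorem tsum_gaussTerm {a b c : ℂ} (hre : 0 < (c - a - b).re) :
    ∑' k, gaussTerm a b c k = gaussValue a b c := by
  have hre' : ∀ n : ℕ, 0 < (c + n - a - b).re := fun n => by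
    simp only [sub_re, add_re, natCast_re] at hre ⊢
    linarith [(n.cast_nonneg : (0 : ℝ) ≤ n)]
  have hne : ∀ n : ℕ, c + n - a - b ≠ 0 := fun n h => by
    have := hre' n
    simp [h] at this
  have down : ∀ n : ℕ, ∑' k, gaussTerm a b (c + n) k = gaussValue a b (c + n) →
      ∑' k, gaussTerm a b c k = gaussValue a b c := fun n => by
    induction n with
    | zero => simp
    | succ n ih =>
      intro h
      refine ih (mul_left_cancel₀ (hne n) ?_)
      rw [tsum_gaussTerm_add_one (hre' n), gaussValue_add_one (hne n), add_assoc]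
      rw [Nat.cast_succ] at h
      rw [h]
  obtain ⟨N, hN⟩ := exists_nat_gt (max (max (-c.re) (a.re - c.re)) (b.re - c.re))
  simp only [max_lt_iff] at hN
  refine down N ?_
  set d := c + N with hd
  have d0 : 0 < d.re := by simp [hd]; linarith
  have d1 : 0 < (d - a).re := by simp [hd]; linarith
  have d2 : 0 < (d - b).re := by simp [hd]; linarith
  have d3 : 0 < (d - a - b).re := hre' N
  have hpos : ∀ (n : ℕ) {z : ℂ}, 0 < z.re → 0 < (z + n).re := fun n z hz => by
    simp only [add_re, natCast_re]
    linarith [(n.cast_nonneg : (0 : ℝ) ≤ n)]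
  have hV : ∀ n : ℕ, gaussValue a b (d + n) ≠ 0 := fun n => by
    rw [gaussValue, show d + n - a - b = d - a - b + n by ring,
      show d + n - a = d - a + n by ring, show d + n - b = d - b + n by ring]
    exact mul_ne_zero (mul_ne_zero (Gamma_ne_zero_of_re_pos (hpos n d3))
      (inv_ne_zero (Gamma_ne_zero_of_re_pos (hpos n d1))))
      (inv_ne_zero (Gamma_ne_zero_of_re_pos (hpos n d2)))
  have hratio : ∀ n : ℕ, (∑' k, gaussTerm a b (d + n) k) / gaussValue a b (d + n) =
      (∑' k, gaussTerm a b d k) / gaussValue a b d := fun n => by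
    induction n with
    | zero => simp
    | succ n ih =>
      have hn := hpos n d3
      rw [show d - a - b + n = d + n - a - b by ring] at hn
      have hn0 : d + n - a - b ≠ 0 := fun h => by simp [h] at hn
      have g1 := tsum_gaussTerm_add_one hn
      have g2 := gaussValue_add_one hn0
      have hV1 := hV (n + 1)
      rw [← ih, Nat.cast_succ, ← add_assoc, div_eq_div_iff
        (by rw [add_assoc, ← Nat.cast_succ]; exact hV1) (hV n)]
      refine mul_left_cancel₀ hn0 ?_
      linear_combination (∑' k, gaussTerm a b (d + n + 1) k) * g2 -
        gaussValue a b (d + n + 1) * g1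
  have hlim := (tendsto_Gamma_mul_tsum_gaussTerm (a := a) (b := b) d0
    (by simp at d3 ⊢; linarith)).div (tendsto_Gamma_mul_gaussValue d0 d1 d2 d3) one_ne_zero
  have hconst : (fun n : ℕ => Gamma (d + (n + 1 : ℕ)) * (∑' k, gaussTerm a b (d + (n + 1 : ℕ)) k) /
      (Gamma (d + (n + 1 : ℕ)) * gaussValue a b (d + (n + 1 : ℕ)))) =
      fun _ => (∑' k, gaussTerm a b d k) / gaussValue a b d := by
    funext n
    rw [mul_div_mul_left _ _ (Gamma_ne_zero_of_re_pos (hpos (n + 1) d0)), hratio]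
  have h1 := tendsto_nhds_unique (tendsto_const_nhds.congr fun n => (congrFun hconst n).symm) hlim
  rw [div_one, div_eq_one_iff_eq (by simpa using hV 0)] at h1
  exact h1

lemma psi_add_one {z : ℂ} (hz : ∀ n : ℕ, z ≠ -n) : ψ (z + 1) = ψ z + z⁻¹ :=
  digamma_apply_add_one z hz

lemma hasDerivAt_Gamma {z : ℂ} (hz : ∀ n : ℕ, z ≠ -n) : HasDerivAt Gamma (ψ z * Gamma z) z := by
  rw [ψ, div_mul_cancel₀ _ (Gamma_ne_zero hz)]
  exact (differentiableAt_Gamma z hz).hasDerivAt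

lemma hasDerivAt_inv_Gamma {z : ℂ} (hz : ∀ n : ℕ, z ≠ -n) :
    HasDerivAt (fun z => (Gamma z)⁻¹) (-ψ z * (Gamma z)⁻¹) z := by
  refine ((hasDerivAt_Gamma hz).fun_inv (Gamma_ne_zero hz)).congr_deriv ?_
  have := Gamma_ne_zero hz
  field_simp

lemma hasDerivAt_inv_Gamma_neg_natCast (n : ℕ) :
    HasDerivAt (fun z => (Gamma z)⁻¹) ((-1) ^ n * (Nat.factorial n : ℂ)) (-n) := by
  induction n with
  | zero =>
    have h : HasDerivAt (fun z : ℂ => z * (Gamma (z + 1))⁻¹)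
        (1 * (Gamma (0 + 1))⁻¹ + 0 * deriv (fun z : ℂ => (Gamma (z + 1))⁻¹) 0) 0 :=
      (hasDerivAt_id 0).mul
        ((differentiable_one_div_Gamma.comp (differentiable_id.add_const 1)) 0).hasDerivAt
    simp only [← inv_Gamma_eq] at h
    simpa using h
  | succ n ih =>
    have h1 : HasDerivAt (fun z : ℂ => (Gamma (z + 1))⁻¹) ((-1) ^ n * (Nat.factorial n : ℂ))
        (-((n + 1 : ℕ) : ℂ)) := by
      refine HasDerivAt.comp_add_const _ _ (f := fun z => (Gamma z)⁻¹) ?_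
      have e : -((n + 1 : ℕ) : ℂ) + 1 = -n := by
        push_cast
        ring
      rwa [e]
    have h := (hasDerivAt_id (-((n + 1 : ℕ) : ℂ))).mul h1
    have h0 : (Gamma (-((n + 1 : ℕ) : ℂ) + 1))⁻¹ = 0 := by
      rw [inv_eq_zero, Gamma_eq_zero_iff]
      exact ⟨n, by push_cast; ring⟩
    rw [h0] at h
    have hf : (fun z : ℂ => (Gamma z)⁻¹) = id * fun z : ℂ => (Gamma (z + 1))⁻¹ :=
      funext inv_Gamma_eq
    rw [hf]
    refine h.congr_deriv ?_
    rw [Nat.factorial_succ]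
    push_cast
    simp only [id]
    ring

lemma hasDerivAt_rf {z : ℂ} (hz : ∀ n : ℕ, z ≠ -n) (k : ℕ) :
    HasDerivAt (fun x => rf x k) (rf z k * (ψ (z + k) - ψ z)) z := by
  induction k with
  | zero => simpa [rf_zero] using hasDerivAt_const z (1 : ℂ)
  | succ k ih =>
    have hk : ∀ n : ℕ, z + k ≠ -n := fun n h => hz (n + k) (by
      push_cast
      linear_combination h)
    have hk0 : z + k ≠ 0 := by simpa using hk 0
    have h := ih.mul ((hasDerivAt_id z).add_const (k : ℂ))
    have hf : (fun x => rf x (k + 1)) = (fun x : ℂ => rf x k) * fun x : ℂ => id x + (k : ℂ) :=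
      funext fun x => rf_succ x k
    rw [hf]
    refine h.congr_deriv ?_
    rw [rf_succ, Nat.cast_succ, ← add_assoc, psi_add_one hk]
    simp only [id]
    field_simp
    ring

/-- The reflection formula for the digamma function. -/
lemma psi_one_sub {z : ℂ} (hz : ∀ n : ℤ, z ≠ n) :
    ψ (1 - z) - ψ z = Real.pi * cot (Real.pi * z) := by
  have hz1 : ∀ n : ℕ, z ≠ -n := fun n h => hz (-n) (by simpa using h)
  have hz2 : ∀ n : ℕ, 1 - z ≠ -n := fun n h => hz (1 + n) (by
    push_cast
    linear_combination -h)
  have hG1 := Gamma_ne_zero hz1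
  have hG2 := Gamma_ne_zero hz2
  have hrefl := Gamma_mul_Gamma_one_sub z
  have hsin : sin (Real.pi * z) ≠ 0 := fun h => by
    rw [h, div_zero] at hrefl
    exact mul_ne_zero hG1 hG2 hrefl
  have hL := (hasDerivAt_Gamma hz1).mul ((hasDerivAt_Gamma hz2).comp_const_sub 1 z)
  have hR := (((hasDerivAt_id z).const_mul (Real.pi : ℂ)).csin.fun_inv hsin).const_mul
    (Real.pi : ℂ)
  have hf : (Gamma * fun x => Gamma (1 - x)) =
      fun x => (Real.pi : ℂ) * (sin ((Real.pi : ℂ) * id x))⁻¹ :=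
    funext fun x => (Gamma_mul_Gamma_one_sub x).trans (div_eq_mul_inv _ _)
  rw [hf] at hL
  have h := hL.unique hR
  simp only [id] at h
  have h' : (ψ z - ψ (1 - z)) * (Gamma z * Gamma (1 - z)) =
      (Real.pi : ℂ) * (-(cos (Real.pi * z) * (Real.pi * 1)) / sin (Real.pi * z) ^ 2) := by
    rw [← h]
    ring
  have hpi : (Real.pi : ℂ) ≠ 0 := by exact_mod_cast Real.pi_ne_zero
  rw [hrefl, mul_div_assoc', div_eq_iff hsin] at h'
  rw [cot_eq_cos_div_sin]
  field_simp at h'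
  rw [mul_comm z] at h'
  linear_combination -h'

lemma cot_pi_mul_sub_natCast (z : ℂ) (m : ℕ) :
    cot (Real.pi * (z - m)) = cot (Real.pi * z) := by
  have e : (Real.pi : ℂ) * (z - m) = Real.pi * z - m * Real.pi := by ring
  have hs : sin (m * Real.pi) = 0 := sin_nat_mul_pi m
  have hc : cos (m * Real.pi) ≠ 0 := fun h => by
    have := sin_sq_add_cos_sq (m * Real.pi : ℂ)
    simp [hs, h] at this
  rw [cot_eq_cos_div_sin, cot_eq_cos_div_sin, e, sin_sub, cos_sub, hs, mul_zero, mul_zero,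
    add_zero, sub_zero, mul_div_mul_right _ _ hc]

lemma rf_sub_natCast (x : ℂ) (n : ℕ) : rf (x - n) n = (-1) ^ n * rf (1 - x) n := by
  have h : ((-1 : ℂ)) ^ n = ∏ j ∈ Finset.range n, (-1 : ℂ) := by simp
  rw [rf, rf, h, ← Finset.prod_mul_distrib, ← Finset.prod_range_reflect]
  refine Finset.prod_congr rfl fun j hj => ?_
  have hj' := Finset.mem_range.1 hj
  rw [Nat.sub_sub, Nat.cast_sub (by omega)]
  push_cast
  ring

lemma rf_one_add_natCast_mul_factorial (k n : ℕ) :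
    rf (1 + k) n * (Nat.factorial k : ℂ) = Nat.factorial (k + n) := by
  have h := Gamma_add_natCast (z := 1 + k) (ne_neg_natCast_of_re_pos (by simp; positivity)) n
  rw [add_comm 1 (k : ℂ), Gamma_nat_eq_factorial, add_right_comm, ← Nat.cast_add,
    Gamma_nat_eq_factorial] at h
  rw [add_comm 1 (k : ℂ), h]

lemma rf_ne_zero {z : ℂ} (hz : ∀ n : ℕ, z ≠ -n) (k : ℕ) : rf z k ≠ 0 := by
  rw [rf, Finset.prod_ne_zero_iff]
  exact fun j _ hj => hz j (eq_neg_of_add_eq_zero_left hj)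

lemma hasSum_deriv_gaussTerm_gaussValue {a b c : ℂ → ℂ} (ha : Differentiable ℂ a)
    (hb : Differentiable ℂ b) (hc : Differentiable ℂ c) {z : ℂ}
    (hre : 0 < (c z - a z - b z).re) :
    HasSum (fun k => deriv (fun w => gaussTerm (a w) (b w) (c w) k) z)
      (deriv (fun w => gaussValue (a w) (b w) (c w)) z) := by
  have h := hasSum_deriv_gaussTerm ha hb hc hre
  have e : (fun w => ∑' k, gaussTerm (a w) (b w) (c w) k) =ᶠ[𝓝 z]
      fun w => gaussValue (a w) (b w) (c w) := by
    filter_upwards [(continuous_re.comp ((hc.sub ha).sub hb).continuous).continuousAt.eventually_const_lt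
      hre] with w hw
    exact tsum_gaussTerm hw
  rwa [e.deriv_eq] at h

lemma gaussTerm_one_add_natCast (a b : ℂ) (m k : ℕ) :
    gaussTerm a b (1 + m) k =
      rf a k * rf b k / ((Nat.factorial (m + k) : ℂ) * (Nat.factorial k : ℂ)) := by
  rw [gaussTerm, add_assoc, ← Nat.cast_add, add_comm 1, Gamma_nat_eq_factorial]
  field_simp

lemma gaussTerm_sub_natCast_add (a b : ℂ) (m k : ℕ) :
    gaussTerm (a - m) (b - m) (1 - m) (k + m) =
      rf (a - m) m * rf (b - m) m * gaussTerm a b (1 + m) k := by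
  have e : (1 : ℂ) - m + ((k + m : ℕ) : ℂ) = k + 1 := by
    push_cast
    ring
  rw [gaussTerm_one_add_natCast, gaussTerm, e, Gamma_nat_eq_factorial, add_comm k m, rf_add,
    rf_add, sub_add_cancel, sub_add_cancel]
  field_simp

lemma hasDerivAt_gaussTerm_right {a b c : ℂ} (hc : ∀ n : ℕ, c ≠ -n) (k : ℕ) :
    HasDerivAt (fun w => gaussTerm a b (c + w) k) (gaussTerm a b c k * -ψ (c + k)) 0 := by
  have hck : ∀ n : ℕ, c + k + 0 ≠ -n := fun n h => hc (n + k) (by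
    push_cast
    linear_combination h)
  have h := (((hasDerivAt_inv_Gamma hck).comp_const_add (c + k) 0).const_mul
    (rf a k * rf b k)).div_const (Nat.factorial k : ℂ)
  have hf : (fun w => gaussTerm a b (c + w) k) =
      fun w => rf a k * rf b k * (Gamma (c + k + w))⁻¹ / (Nat.factorial k : ℂ) := by
    funext w
    rw [gaussTerm, add_right_comm]
  rw [hf]
  refine h.congr_deriv ?_
  rw [gaussTerm, add_zero]
  ring

/-- Derivative of a Gauss term when all parameters move with unit speed to the left. -/
lemma hasDerivAt_gaussTerm_sub {a b c g' : ℂ} (ha : ∀ n : ℕ, a ≠ -n) (hb : ∀ n : ℕ, b ≠ -n)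
    {k : ℕ} (hg : HasDerivAt (fun z => (Gamma z)⁻¹) g' (c + k)) :
    HasDerivAt (fun w => gaussTerm (a - w) (b - w) (c - w) k)
      (-rf a k * rf b k / (Nat.factorial k : ℂ) *
        ((ψ (a + k) - ψ a + (ψ (b + k) - ψ b)) * (Gamma (c + k))⁻¹ + g')) 0 := by
  have h1 := HasDerivAt.comp_const_sub a 0 (by rw [sub_zero]; exact hasDerivAt_rf ha k)
  have h2 := HasDerivAt.comp_const_sub b 0 (by rw [sub_zero]; exact hasDerivAt_rf hb k)
  have h3 := HasDerivAt.comp_const_sub (c + k) 0 (by rw [sub_zero]; exact hg)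
  have h := ((h1.fun_mul h2).fun_mul h3).div_const (Nat.factorial k : ℂ)
  have hf : (fun w => gaussTerm (a - w) (b - w) (c - w) k) =
      fun w => rf (a - w) k * rf (b - w) k * (Gamma (c + k - w))⁻¹ / (Nat.factorial k : ℂ) := by
    funext w
    rw [gaussTerm, sub_add_eq_add_sub]
  rw [hf]
  refine h.congr_deriv ?_
  simp only [sub_zero]
  ring

lemma hasDerivAt_gaussValue_right {a b c : ℂ} (h0 : ∀ n : ℕ, c - a - b ≠ -n)
    (h1 : ∀ n : ℕ, c - a ≠ -n) (h2 : ∀ n : ℕ, c - b ≠ -n) :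
    HasDerivAt (fun w => gaussValue a b (c + w))
      (gaussValue a b c * (ψ (c - a - b) - ψ (c - a) - ψ (c - b))) 0 := by
  have d0 := HasDerivAt.comp_const_add (c - a - b) 0 (by rw [add_zero]; exact hasDerivAt_Gamma h0)
  have d1 := HasDerivAt.comp_const_add (c - a) 0 (by rw [add_zero]; exact hasDerivAt_inv_Gamma h1)
  have d2 := HasDerivAt.comp_const_add (c - b) 0 (by rw [add_zero]; exact hasDerivAt_inv_Gamma h2)
  have h := (d0.fun_mul d1).fun_mul d2
  have hf : (fun w => gaussValue a b (c + w)) = fun w =>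
      Gamma (c - a - b + w) * (Gamma (c - a + w))⁻¹ * (Gamma (c - b + w))⁻¹ := by
    funext w
    rw [gaussValue]
    congr 3 <;> ring_nf
  rw [hf]
  refine h.congr_deriv ?_
  simp only [add_zero, gaussValue]
  ring

lemma hasDerivAt_gaussValue_sub {a b c : ℂ} (h0 : ∀ n : ℕ, c - a - b ≠ -n) :
    HasDerivAt (fun w => gaussValue (a - w) (b - w) (c - w))
      (gaussValue a b c * ψ (c - a - b)) 0 := by
  have d0 := HasDerivAt.comp_const_add (c - a - b) 0 (by rw [add_zero]; exact hasDerivAt_Gamma h0)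
  have h := d0.mul_const ((Gamma (c - a))⁻¹ * (Gamma (c - b))⁻¹)
  have hf : (fun w => gaussValue (a - w) (b - w) (c - w)) = fun w =>
      Gamma (c - a - b + w) * ((Gamma (c - a))⁻¹ * (Gamma (c - b))⁻¹) := by
    funext w
    rw [gaussValue, mul_assoc]
    congr 3 <;> ring_nf
  rw [hf]
  refine h.congr_deriv ?_
  simp only [gaussValue]
  ring

lemma rf_sub_natCast_eq_mul (c : ℂ) (k n : ℕ) :
    rf (c - (k + n + 1 : ℕ)) (k + n + 1) =
      rf (c - (k + n + 1 : ℕ)) k * ((-1) ^ (n + 1) * ((1 - c) * rf (2 - c) n)) := by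
  have e : c - (k + n + 1 : ℕ) + k = c - (n + 1 : ℕ) := by
    push_cast
    ring
  have h1 : rf (1 - c) (n + 1) = (1 - c) * rf (2 - c) n := by
    rw [add_comm n 1, rf_add]
    congr 1
    · simp [rf]
    · congr 1
      push_cast
      ring
  rw [← h1, ← rf_sub_natCast, ← e, add_assoc k n 1, rf_add]

lemma factorial_mul_rf_div_eq {c₁ c₂ : ℂ} (h1 : ∀ n : ℤ, c₁ ≠ n) (h2 : ∀ n : ℤ, c₂ ≠ n)
    (k n : ℕ) :
    rf (c₁ - (k + n + 1 : ℕ)) k * rf (c₂ - (k + n + 1 : ℕ)) k / (Nat.factorial k : ℂ) *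
        ((-1) ^ n * Nat.factorial n) =
      rf (c₁ - (k + n + 1 : ℕ)) (k + n + 1) * rf (c₂ - (k + n + 1 : ℕ)) (k + n + 1) *
        (1 / ((1 - c₁) * (1 - c₂) * (Nat.factorial (k + n) : ℂ)) *
          (rf (1 - ((k + n + 1 : ℕ) : ℂ)) n * Nat.factorial n / (rf (2 - c₁) n * rf (2 - c₂) n))) := by
  have e : (1 : ℂ) - ((k + n + 1 : ℕ) : ℂ) = -k - n := by
    push_cast
    ring
  have hk : (Nat.factorial k : ℂ) ≠ 0 := by exact_mod_cast k.factorial_ne_zero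
  have hkn : (Nat.factorial (k + n) : ℂ) ≠ 0 := by exact_mod_cast (k + n).factorial_ne_zero
  have hr : rf (1 - ((k + n + 1 : ℕ) : ℂ)) n = (-1) ^ n * (Nat.factorial (k + n) / Nat.factorial k) := by
    rw [e, rf_sub_natCast, sub_neg_eq_add, ← rf_one_add_natCast_mul_factorial,
      mul_div_cancel_right₀ _ hk]
  have hne : ∀ {c : ℂ}, (∀ n : ℤ, c ≠ n) → 1 - c ≠ 0 ∧ rf (2 - c) n ≠ 0 := fun {c} hc =>
    ⟨fun h => hc 1 (by push_cast; linear_combination -h),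
      rf_ne_zero (fun j h => hc (2 + j) (by push_cast; linear_combination -h)) n⟩
  obtain ⟨p1, q1⟩ := hne h1
  obtain ⟨p2, q2⟩ := hne h2
  have hsq : ((-1 : ℂ) ^ n) ^ 2 = 1 := by rw [← pow_mul, mul_comm, pow_mul]; simp
  rw [hr, rf_sub_natCast_eq_mul, rf_sub_natCast_eq_mul]
  generalize rf (c₁ - (k + n + 1 : ℕ)) k = A
  generalize rf (c₂ - (k + n + 1 : ℕ)) k = B
  rw [pow_succ]
  field_simp
  rw [hsq, mul_one]

theorem stmt12 (m : ℕ) (hm : 1 ≤ m) (c₁ c₂ : ℂ)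
    (h1 : ∀ n : ℤ, c₁ ≠ n) (h2 : ∀ n : ℤ, c₂ ≠ n)
    (hre : (c₁ + c₂).re < m + 1) :
    (∑' k : ℕ, rf c₁ k * rf c₂ k /
        ((Nat.factorial (m + k) : ℂ) * (Nat.factorial k : ℂ)) *
        (ψ (1 + k) + ψ (1 + m + k) - ψ (c₁ + k) - ψ (c₂ + k))) =
      (Real.pi : ℂ) * (Complex.cot ((Real.pi : ℂ) * c₁) + Complex.cot ((Real.pi : ℂ) * c₂)) *
        (Complex.Gamma (1 + m - c₁ - c₂) /
          (Complex.Gamma (1 + m - c₁) * Complex.Gamma (1 + m - c₂))) +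
      (1 / ((1 - c₁) * (1 - c₂) * (Nat.factorial (m - 1) : ℂ))) *
        ∑ k ∈ Finset.range m, rf (1 - (m : ℂ)) k * (Nat.factorial k : ℂ) /
          (rf (2 - c₁) k * rf (2 - c₂) k) := by
  have hre0 : 0 < (1 + m - c₁ - c₂ : ℂ).re := by
    simp only [sub_re, add_re, one_re, natCast_re] at hre ⊢
    linarith
  have hnat : ∀ {c : ℂ}, (∀ n : ℤ, c ≠ n) → (∀ n : ℕ, c - m ≠ -n) ∧ (∀ n : ℕ, 1 + m - c ≠ -n) ∧
      (∀ n : ℤ, c - m ≠ n) ∧ (∀ n : ℕ, 1 - c ≠ -n) := fun {c} hc =>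
    ⟨fun n h => hc (m - n) (by push_cast; linear_combination h),
      fun n h => hc (1 + m + n) (by push_cast; linear_combination -h),
      fun n h => hc (m + n) (by push_cast; linear_combination h),
      fun n h => hc (1 + n) (by push_cast; linear_combination -h)⟩
  obtain ⟨a1, b1, z1, o1⟩ := hnat h1
  obtain ⟨a2, b2, z2, o2⟩ := hnat h2
  have hpole := ne_neg_natCast_of_re_pos hre0
  have hpole1 : ∀ n : ℕ, (1 + m : ℂ) ≠ -n := ne_neg_natCast_of_re_pos (by simp; positivity)
  have e0 : (1 - m : ℂ) - (c₁ - m) - (c₂ - m) = 1 + m - c₁ - c₂ := by ring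
  have e1 : (1 - m : ℂ) - (c₁ - m) = 1 - c₁ := by ring
  have e2 : (1 - m : ℂ) - (c₂ - m) = 1 - c₂ := by ring
  set R := rf (c₁ - m) m * rf (c₂ - m) m with hR
  set G := gaussValue c₁ c₂ (1 + m) with hG
  set t := gaussTerm c₁ c₂ (1 + m) with ht
  have hR0 : R ≠ 0 := mul_ne_zero (rf_ne_zero a1 m) (rf_ne_zero a2 m)
  have H3 : HasSum t G := by
    rw [hG, ← tsum_gaussTerm hre0]
    exact (summable_gaussTerm hre0).hasSum
  have H1 : HasSum (fun k => t k * -ψ (1 + m + k))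
      (G * (ψ (1 + m - c₁ - c₂) - ψ (1 + m - c₁) - ψ (1 + m - c₂))) := by
    have h := hasSum_deriv_gaussTerm_gaussValue (a := fun _ => c₁) (b := fun _ => c₂)
      (c := fun w => 1 + m + w) (z := 0) (by fun_prop) (by fun_prop) (by fun_prop)
      (by simpa using hre0)
    simp only [(hasDerivAt_gaussValue_right hpole b1 b2).deriv,
      (hasDerivAt_gaussTerm_right hpole1 _).deriv] at h
    exact h
  have H2 := hasSum_deriv_gaussTerm_gaussValue (a := fun w => c₁ - m - w)
    (b := fun w => c₂ - m - w) (c := fun w => 1 - m - w) (z := 0) (by fun_prop) (by fun_prop)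
    (by fun_prop) (by simpa only [sub_zero, e0] using hre0)
  rw [(hasDerivAt_gaussValue_sub (by rw [e0]; exact hpole)).deriv, e0] at H2
  have hRG : gaussValue (c₁ - m) (c₂ - m) (1 - m) = R * G := by
    have hs : ((-1 : ℂ) ^ m) * (-1) ^ m = 1 := by rw [← mul_pow]; simp
    have g1 := Gamma_add_natCast o1 m
    have g2 := Gamma_add_natCast o2 m
    have n1 := Gamma_ne_zero o1
    have n2 := Gamma_ne_zero o2
    have r1 := rf_ne_zero o1 m
    have r2 := rf_ne_zero o2 m
    rw [hR, hG, gaussValue, gaussValue, e0, e1, e2, rf_sub_natCast, rf_sub_natCast,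
      show (1 + m - c₁ : ℂ) = 1 - c₁ + m by ring, show (1 + m - c₂ : ℂ) = 1 - c₂ + m by ring,
      g1, g2]
    field_simp
    linear_combination -Gamma (1 - c₁ + m - c₂) * hs
  rw [hRG] at H2
  set d : ℕ → ℂ :=
    fun k => deriv (fun w => gaussTerm (c₁ - m - w) (c₂ - m - w) (1 - m - w) k) 0 with hd
  have hshift : ∀ k : ℕ, d (k + m) =
      R * (t k * (ψ (1 + k) - (ψ (c₁ + k) - ψ (c₁ - m)) - (ψ (c₂ + k) - ψ (c₂ - m)))) := fun k => by
    have e : (1 : ℂ) - m + ((k + m : ℕ) : ℂ) = 1 + k := by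
      push_cast
      ring
    have ea : ∀ c : ℂ, c - m + ((k + m : ℕ) : ℂ) = c + k := fun c => by
      push_cast
      ring
    have hg := hasDerivAt_inv_Gamma (z := (1 : ℂ) - m + ((k + m : ℕ) : ℂ))
      (by rw [e]; exact ne_neg_natCast_of_re_pos (by simp; positivity))
    have hT := gaussTerm_sub_natCast_add c₁ c₂ m k
    rw [← hR, ← ht, gaussTerm] at hT
    simp only [hd]
    rw [(hasDerivAt_gaussTerm_sub a1 a2 hg).deriv, ← mul_assoc, ← hT, ea, ea, e]
    ring
  have hfin : ∑ k ∈ Finset.range m, d k =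
      -R * (1 / ((1 - c₁) * (1 - c₂) * (Nat.factorial (m - 1) : ℂ)) *
        ∑ k ∈ Finset.range m, rf (1 - (m : ℂ)) k * (Nat.factorial k : ℂ) /
          (rf (2 - c₁) k * rf (2 - c₂) k)) := by
    rw [Finset.mul_sum, Finset.mul_sum, ← Finset.sum_range_reflect d]
    refine Finset.sum_congr rfl fun n hn => ?_
    obtain ⟨k, rfl⟩ : ∃ k, m = k + n + 1 := ⟨m - 1 - n, by have := Finset.mem_range.1 hn; omega⟩
    rw [show k + n + 1 - 1 - n = k by omega, show k + n + 1 - 1 = k + n by omega]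
    have e : (1 : ℂ) - ((k + n + 1 : ℕ) : ℂ) + k = -n := by
      push_cast
      ring
    have hg : HasDerivAt (fun z => (Gamma z)⁻¹) ((-1) ^ n * (Nat.factorial n : ℂ))
        (1 - ((k + n + 1 : ℕ) : ℂ) + k) := by
      rw [e]
      exact hasDerivAt_inv_Gamma_neg_natCast n
    have h0 : (Gamma (-(n : ℂ)))⁻¹ = 0 := inv_eq_zero.2 (Gamma_neg_nat_eq_zero n)
    have hkey := factorial_mul_rf_div_eq h1 h2 k n
    rw [← hR] at hkey
    simp only [hd]
    rw [(hasDerivAt_gaussTerm_sub a1 a2 hg).deriv, e, h0]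
    linear_combination -hkey
  have H := ((((hasSum_nat_add_iff' m).2 H2).mul_left R⁻¹).sub
    (H3.mul_left (ψ (c₁ - m) + ψ (c₂ - m)))).sub H1
  have hterm : ∀ k : ℕ, rf c₁ k * rf c₂ k / ((Nat.factorial (m + k) : ℂ) * (Nat.factorial k : ℂ)) *
      (ψ (1 + k) + ψ (1 + m + k) - ψ (c₁ + k) - ψ (c₂ + k)) =
      R⁻¹ * d (k + m) - (ψ (c₁ - m) + ψ (c₂ - m)) * t k - t k * -ψ (1 + m + k) := fun k => by
    rw [← gaussTerm_one_add_natCast, ← ht, hshift, inv_mul_cancel_left₀ hR0]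
    ring
  rw [tsum_congr hterm, H.tsum_eq, hfin]
  have r1 := psi_one_sub z1
  have r2 := psi_one_sub z2
  rw [cot_pi_mul_sub_natCast, show 1 - (c₁ - m) = 1 + m - c₁ by ring] at r1
  rw [cot_pi_mul_sub_natCast, show 1 - (c₂ - m) = 1 + m - c₂ by ring] at r2
  have hG' : Gamma (1 + m - c₁ - c₂) / (Gamma (1 + m - c₁) * Gamma (1 + m - c₂)) = G := by
    rw [hG, gaussValue, div_eq_mul_inv, mul_inv, mul_assoc]
  rw [hG', mul_sub, neg_mul, mul_neg, inv_mul_cancel_left₀ hR0, mul_assoc R,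
    inv_mul_cancel_left₀ hR0, mul_add, ← r1, ← r2]
  ring
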